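/- In (End ℂⁿ)^{⊗m} ⊗ W_n, set L = M𝒟 − (q − q⁻¹)⁻¹·1 and z = (q − q⁻¹)⁻¹. For every partition μ of m with at most n rows and every standard μ-tableau U, one has tr_{q(1,…,m)} (L_{1̄} + z q^{−2c_1(U)}) ⋯ (L_{m̄} + z q^{−2c_m(U)}) E_U = a_μ · tr_{q(1,…,m)} M_{1̄} ⋯ M_{m̄} 𝒟_{m̄} ⋯ 𝒟_{1̄} E_U, where a_μ = ∏_{α∈μ} q^{−2c(α)}; that is, the image of the q-immanant polynomial S_μ(z) at z = (q − q⁻¹)⁻¹ under the homomorphism L ↦ M𝒟 − (q − q⁻¹)⁻¹ is a_μ tr_{q(1,…,m)} M_{1̄} ⋯ M_{m̄} 𝒟_{m̄} ⋯ 𝒟_{1̄} E_U. -/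

import Mathlib

open scoped Classical

noncomputable section

namespace QImm

/-- `q` is not a root of unity. -/
def NotRootOfUnity (q : ℂ) : Prop := ∀ k : ℕ, 0 < k → q ^ k ≠ 1

/-! ### The R-matrices -/

/-- The R-matrix `R = q ∑ eᵢᵢ⊗eᵢᵢ + ∑_{i≠j} eᵢᵢ⊗eⱼⱼ + (q-q⁻¹) ∑_{i<j} eᵢⱼ⊗eⱼᵢ`. -/
def Rmat (q : ℂ) (n : ℕ) : Matrix (Fin n × Fin n) (Fin n × Fin n) ℂ := fun p r =>
  if p.1 = r.1 ∧ p.2 = r.2 then (if p.1 = p.2 then q else 1)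
  else if p.2 = r.1 ∧ p.1 = r.2 ∧ p.1 < r.1 then q - q⁻¹ else 0

/-- The permutation operator `P = ∑ eᵢⱼ⊗eⱼᵢ`. -/
def Pmat (n : ℕ) : Matrix (Fin n × Fin n) (Fin n × Fin n) ℂ := fun p r =>
  if p.1 = r.2 ∧ p.2 = r.1 then 1 else 0

/-- `Ř = P R`. -/
def Rcheck (q : ℂ) (n : ℕ) : Matrix (Fin n × Fin n) (Fin n × Fin n) ℂ :=
  Pmat n * Rmat q n

/-! ### Embeddings into tensor legs: `(End ℂⁿ)^{⊗m} ⊗ A ≅ Matrix (Fin m → Fin n) (Fin m → Fin n) A` -/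

/-- An `n×n` matrix over `A` placed in the `a`-th tensor leg (0-indexed) of
`(End ℂⁿ)^{⊗m} ⊗ A`. -/
def leg1 {A : Type} [Ring A] (n m : ℕ) (X : Matrix (Fin n) (Fin n) A) (a : ℕ) :
    Matrix (Fin m → Fin n) (Fin m → Fin n) A := fun i j =>
  if h : a < m then
    if ∀ c : Fin m, (c : ℕ) ≠ a → i c = j c then X (i ⟨a, h⟩) (j ⟨a, h⟩) else 0
  else 0

/-- A scalar element of `End ℂⁿ ⊗ End ℂⁿ` placed in the `a`-th and `b`-th tensor legs
(0-indexed) of `(End ℂⁿ)^{⊗m} ⊗ A`. -/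
def leg2 (A : Type) [Ring A] [Algebra ℂ A] (n m : ℕ)
    (C : Matrix (Fin n × Fin n) (Fin n × Fin n) ℂ) (a b : ℕ) :
    Matrix (Fin m → Fin n) (Fin m → Fin n) A := fun i j =>
  if h : a < m ∧ b < m then
    if ∀ c : Fin m, (c : ℕ) ≠ a → (c : ℕ) ≠ b → i c = j c then
      algebraMap ℂ A (C (i ⟨a, h.1⟩, i ⟨b, h.2⟩) (j ⟨a, h.1⟩, j ⟨b, h.2⟩))
    else 0
  else 0

/-- `Ř_{k+1}` (paper numbering), acting in the tensor legs `k`, `k+1` (0-indexed). -/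
def RcLeg (A : Type) [Ring A] [Algebra ℂ A] (q : ℂ) (n m : ℕ) (k : ℕ) :
    Matrix (Fin m → Fin n) (Fin m → Fin n) A :=
  leg2 A n m (Rcheck q n) k (k + 1)

/-- `Ř⁻¹_{k+1}` (paper numbering), acting in the tensor legs `k`, `k+1` (0-indexed). -/
def RcLegInv (A : Type) [Ring A] [Algebra ℂ A] (q : ℂ) (n m : ℕ) (k : ℕ) :
    Matrix (Fin m → Fin n) (Fin m → Fin n) A :=
  leg2 A n m (Rcheck q n)⁻¹ k (k + 1)

/-- `legBar q n m X k` is `X_{\overline{k+1}}` (paper numbering), so `legBar q n m X 0 = X₁`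
and `X_{\overline{k+1}} = Ř_k X_{\overline{k}} Ř_k⁻¹`. -/
def legBar {A : Type} [Ring A] [Algebra ℂ A] (q : ℂ) (n m : ℕ)
    (X : Matrix (Fin n) (Fin n) A) : ℕ → Matrix (Fin m → Fin n) (Fin m → Fin n) A
  | 0 => leg1 n m X 0
  | k + 1 => RcLeg A q n m k * legBar q n m X k * RcLegInv A q n m k

/-! ### q-traces -/

/-- The q-trace over all `m` tensor legs: `tr_{q(1,…,m)} Y = tr D₁⋯D_m Y` with
`D = diag(1, q⁻², …, q^{-2n+2})`. -/
def qTr {A : Type} [Ring A] [Algebra ℂ A] (q : ℂ) (n m : ℕ)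
    (Y : Matrix (Fin m → Fin n) (Fin m → Fin n) A) : A :=
  ∑ i : Fin m → Fin n,
    algebraMap ℂ A (∏ a : Fin m, q ^ (-2 * ((i a : ℕ) : ℤ))) * Y i i

/-- The q-trace of a single `n×n` matrix: `tr_q X = tr D X`. -/
def qTr1 {A : Type} [Ring A] [Algebra ℂ A] (q : ℂ) (n : ℕ)
    (X : Matrix (Fin n) (Fin n) A) : A :=
  ∑ j : Fin n, algebraMap ℂ A (q ^ (-2 * ((j : ℕ) : ℤ))) * X j j

/-! ### The Hecke algebra -/

/-- The defining relations of the Hecke algebra `H_m` on generators `T_1, …, T_{m-1}`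
(the generator `i : Fin (m-1)` is `T_{i+1}` in 1-indexed paper notation). -/
inductive HeckeRel (q : ℂ) (m : ℕ) :
    FreeAlgebra ℂ (Fin (m - 1)) → FreeAlgebra ℂ (Fin (m - 1)) → Prop
  | quad (i : Fin (m - 1)) :
      HeckeRel q m
        ((FreeAlgebra.ι ℂ i - algebraMap ℂ (FreeAlgebra ℂ (Fin (m - 1))) q) *
          (FreeAlgebra.ι ℂ i + algebraMap ℂ (FreeAlgebra ℂ (Fin (m - 1))) q⁻¹)) 0
  | braid (i j : Fin (m - 1)) (h : (j : ℕ) = (i : ℕ) + 1) :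
      HeckeRel q m (FreeAlgebra.ι ℂ i * FreeAlgebra.ι ℂ j * FreeAlgebra.ι ℂ i)
        (FreeAlgebra.ι ℂ j * FreeAlgebra.ι ℂ i * FreeAlgebra.ι ℂ j)
  | commute (i j : Fin (m - 1)) (h : (i : ℕ) + 1 < (j : ℕ)) :
      HeckeRel q m (FreeAlgebra.ι ℂ i * FreeAlgebra.ι ℂ j)
        (FreeAlgebra.ι ℂ j * FreeAlgebra.ι ℂ i)

/-- The Hecke algebra `H_m`. -/
abbrev Hecke (q : ℂ) (m : ℕ) := RingQuot (HeckeRel q m)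

/-- The generator `T_{i+1}` (paper 1-indexed) of `H_m`. -/
def Tgen (q : ℂ) (m : ℕ) (i : Fin (m - 1)) : Hecke q m :=
  RingQuot.mkAlgHom ℂ (HeckeRel q m) (FreeAlgebra.ι ℂ i)

/-- `T_{k+1}` (paper 1-indexed), i.e. the 0-indexed `k`-th generator; junk value `1`
out of range. -/
def Tn (q : ℂ) (m : ℕ) (k : ℕ) : Hecke q m :=
  if h : k < m - 1 then Tgen q m ⟨k, h⟩ else 1

/-- The paper's 1-indexed generator `T_a`, `a = 1, …, m-1`. -/
def Tp (q : ℂ) (m : ℕ) (a : ℕ) : Hecke q m := Tn q m (a - 1)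

/-- The Jucys–Murphy elements, 1-indexed: `y_1 = 1`, `y_{k+1} = T_k ⋯ T_2 T_1² T_2 ⋯ T_k`
(the value at `0` is a junk value `1`). -/
def yJM (q : ℂ) (m : ℕ) : ℕ → Hecke q m
  | 0 => 1
  | 1 => 1
  | k + 2 => Tp q m (k + 1) * yJM q m (k + 1) * Tp q m (k + 1)

/-- The element `T_{(i,j)} = T_i T_{i+1} ⋯ T_{j-2} T_{j-1} T_{j-2} ⋯ T_{i+1} T_i` of `H_m`
associated with the transposition `(i,j)`, `1 ≤ i < j` (paper 1-indexed). -/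
def Ttrans (q : ℂ) (m : ℕ) (i j : ℕ) : Hecke q m :=
  ((List.range' i (j - i)).map (Tp q m)).prod *
    (((List.range' i (j - 1 - i)).map (Tp q m)).reverse).prod

/-- The condition that `φ : H_m → End((ℂⁿ)^{⊗m})` is the algebra homomorphism sending
`T_k ↦ Ř_k`. -/
def IsHeckeRep (q : ℂ) (n m : ℕ)
    (φ : Hecke q m →ₐ[ℂ] Matrix (Fin m → Fin n) (Fin m → Fin n) ℂ) : Prop :=
  ∀ k : ℕ, k < m - 1 → φ (Tn q m k) = RcLeg ℂ q n m k

/-! ### Young diagrams and standard tableaux -/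

/-- The content `c(α) = j - i` of a box `α = (i, j)` (row `i`, column `j`, 0-indexed). -/
def ctn (α : ℕ × ℕ) : ℤ := (α.2 : ℤ) - (α.1 : ℤ)

/-- A standard tableau of shape `μ` with `m` boxes, recorded via the position `pos k` of
each entry `k ∈ {1, …, m}`; entries strictly increase along rows and down columns. -/
structure StdTab (μ : YoungDiagram) (m : ℕ) where
  pos : ℕ → ℕ × ℕ
  bij : Set.BijOn pos (Set.Icc 1 m) (μ.cells : Set (ℕ × ℕ))
  row_lt : ∀ k ∈ Set.Icc 1 m, ∀ l ∈ Set.Icc 1 m,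
    (pos k).1 = (pos l).1 → (pos k).2 < (pos l).2 → k < l
  col_lt : ∀ k ∈ Set.Icc 1 m, ∀ l ∈ Set.Icc 1 m,
    (pos k).2 = (pos l).2 → (pos k).1 < (pos l).1 → k < l

/-- `c_k(U)`, the content of the box of `U` occupied by `k`. -/
def ctnAt {μ : YoungDiagram} {m : ℕ} (U : StdTab μ m) (k : ℕ) : ℤ := ctn (U.pos k)

/-- The condition singling out the primitive idempotent `e_U` of `H_m` associated with a
standard tableau `U`: a nonzero idempotent with `y_k e_U = e_U y_k = q^{2c_k(U)} e_U`. -/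
def IsJMIdem (q : ℂ) (m : ℕ) {μ : YoungDiagram} (U : StdTab μ m) (e : Hecke q m) : Prop :=
  e ≠ 0 ∧ e * e = e ∧ ∀ k : ℕ, 1 ≤ k → k ≤ m →
    yJM q m k * e = (q ^ (2 * ctnAt U k) : ℂ) • e ∧
    e * yJM q m k = (q ^ (2 * ctnAt U k) : ℂ) • e

/-! ### The quantized enveloping algebra `U_q(gl_n)` -/

/-- Generators: `inl (i,j) ↦ l⁺_{ij}`, `inr (i,j) ↦ l⁻_{ij}`. -/
abbrev UqGen (n : ℕ) := (Fin n × Fin n) ⊕ (Fin n × Fin n)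

def lpF (n : ℕ) (i j : Fin n) : FreeAlgebra ℂ (UqGen n) := FreeAlgebra.ι ℂ (Sum.inl (i, j))
def lmF (n : ℕ) (i j : Fin n) : FreeAlgebra ℂ (UqGen n) := FreeAlgebra.ι ℂ (Sum.inr (i, j))

/-- A matrix `X` over `F` placed in the first of two matrix legs of
`End ℂⁿ ⊗ End ℂⁿ ⊗ F`. -/
def M1 {F : Type} [Ring F] {n : ℕ} (X : Fin n → Fin n → F) :
    Matrix (Fin n × Fin n) (Fin n × Fin n) F := fun p r => if p.2 = r.2 then X p.1 r.1 else 0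

/-- A matrix `X` over `F` placed in the second of two matrix legs of
`End ℂⁿ ⊗ End ℂⁿ ⊗ F`. -/
def M2 {F : Type} [Ring F] {n : ℕ} (X : Fin n → Fin n → F) :
    Matrix (Fin n × Fin n) (Fin n × Fin n) F := fun p r => if p.1 = r.1 then X p.2 r.2 else 0

/-- The R-matrix, viewed over the free algebra on the generators of `U_q(gl_n)`. -/
def RmatU (q : ℂ) (n : ℕ) : Matrix (Fin n × Fin n) (Fin n × Fin n) (FreeAlgebra ℂ (UqGen n)) :=
  (Rmat q n).map (algebraMap ℂ (FreeAlgebra ℂ (UqGen n)))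

/-- The defining relations of `U_q(gl_n)`. -/
inductive UqRel (q : ℂ) (n : ℕ) :
    FreeAlgebra ℂ (UqGen n) → FreeAlgebra ℂ (UqGen n) → Prop
  | upperZero (i j : Fin n) (h : j < i) : UqRel q n (lpF n i j) 0
  | lowerZero (i j : Fin n) (h : i < j) : UqRel q n (lmF n i j) 0
  | diagPM (i : Fin n) : UqRel q n (lpF n i i * lmF n i i) 1
  | diagMP (i : Fin n) : UqRel q n (lmF n i i * lpF n i i) 1
  | rllPP (x y : Fin n × Fin n) :
      UqRel q n ((RmatU q n * M1 (lpF n) * M2 (lpF n)) x y)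
        ((M2 (lpF n) * M1 (lpF n) * RmatU q n) x y)
  | rllMM (x y : Fin n × Fin n) :
      UqRel q n ((RmatU q n * M1 (lmF n) * M2 (lmF n)) x y)
        ((M2 (lmF n) * M1 (lmF n) * RmatU q n) x y)
  | rllPM (x y : Fin n × Fin n) :
      UqRel q n ((RmatU q n * M1 (lpF n) * M2 (lmF n)) x y)
        ((M2 (lmF n) * M1 (lpF n) * RmatU q n) x y)

/-- The quantized enveloping algebra `U_q(gl_n)`. -/
abbrev Uq (q : ℂ) (n : ℕ) := RingQuot (UqRel q n)

def lp (q : ℂ) (n : ℕ) (i j : Fin n) : Uq q n := RingQuot.mkAlgHom ℂ (UqRel q n) (lpF n i j)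
def lm (q : ℂ) (n : ℕ) (i j : Fin n) : Uq q n := RingQuot.mkAlgHom ℂ (UqRel q n) (lmF n i j)

/-- The matrix `L⁺`. -/
def Lp (q : ℂ) (n : ℕ) : Matrix (Fin n) (Fin n) (Uq q n) := Matrix.of fun i j => lp q n i j
/-- The matrix `L⁻`. -/
def Lm (q : ℂ) (n : ℕ) : Matrix (Fin n) (Fin n) (Uq q n) := Matrix.of fun i j => lm q n i j

/-- `L = L⁺ (L⁻)⁻¹`, where `K` is the (two-sided) inverse of `L⁻`. -/
def Lmat (q : ℂ) (n : ℕ) (K : Matrix (Fin n) (Fin n) (Uq q n)) :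
    Matrix (Fin n) (Fin n) (Uq q n) := Lp q n * K

/-! ### The braided Weyl algebra -/

/-- Generators: `inl (i,j) ↦ m_{ij}`, `inr (i,j) ↦ ∂_{ij}`. -/
abbrev WGen (n : ℕ) := (Fin n × Fin n) ⊕ (Fin n × Fin n)

def mgF (n : ℕ) (i j : Fin n) : FreeAlgebra ℂ (WGen n) := FreeAlgebra.ι ℂ (Sum.inl (i, j))
def dgF (n : ℕ) (i j : Fin n) : FreeAlgebra ℂ (WGen n) := FreeAlgebra.ι ℂ (Sum.inr (i, j))

def RcW (q : ℂ) (n : ℕ) : Matrix (Fin n × Fin n) (Fin n × Fin n) (FreeAlgebra ℂ (WGen n)) :=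
  (Rcheck q n).map (algebraMap ℂ (FreeAlgebra ℂ (WGen n)))

def RcWInv (q : ℂ) (n : ℕ) : Matrix (Fin n × Fin n) (Fin n × Fin n) (FreeAlgebra ℂ (WGen n)) :=
  ((Rcheck q n)⁻¹).map (algebraMap ℂ (FreeAlgebra ℂ (WGen n)))

/-- The defining relations of the braided Weyl algebra `W_n`. -/
inductive WRel (q : ℂ) (n : ℕ) :
    FreeAlgebra ℂ (WGen n) → FreeAlgebra ℂ (WGen n) → Prop
  | mm (x y : Fin n × Fin n) :
      WRel q n ((RcW q n * M1 (mgF n) * RcW q n * M1 (mgF n)) x y)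
        ((M1 (mgF n) * RcW q n * M1 (mgF n) * RcW q n) x y)
  | dd (x y : Fin n × Fin n) :
      WRel q n ((RcWInv q n * M1 (dgF n) * RcWInv q n * M1 (dgF n)) x y)
        ((M1 (dgF n) * RcWInv q n * M1 (dgF n) * RcWInv q n) x y)
  | dm (x y : Fin n × Fin n) :
      WRel q n ((M1 (dgF n) * RcW q n * M1 (mgF n)) x y)
        ((RcW q n * M1 (mgF n) * RcWInv q n * M1 (dgF n) * RcWInv q n + 1) x y)

/-- The braided Weyl algebra `W_n`. -/
abbrev Weyl (q : ℂ) (n : ℕ) := RingQuot (WRel q n)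

def mW (q : ℂ) (n : ℕ) (i j : Fin n) : Weyl q n := RingQuot.mkAlgHom ℂ (WRel q n) (mgF n i j)
def dW (q : ℂ) (n : ℕ) (i j : Fin n) : Weyl q n := RingQuot.mkAlgHom ℂ (WRel q n) (dgF n i j)

/-- The matrix `M = [m_{ij}]` over `W_n`. -/
def Mmat (q : ℂ) (n : ℕ) : Matrix (Fin n) (Fin n) (Weyl q n) := Matrix.of fun i j => mW q n i j
/-- The matrix `𝒟 = [∂_{ij}]` over `W_n`. -/
def Dmat (q : ℂ) (n : ℕ) : Matrix (Fin n) (Fin n) (Weyl q n) := Matrix.of fun i j => dW q n i j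

/-- The image `L = M𝒟 - (q - q⁻¹)⁻¹·1` of `L` in the braided Weyl algebra. -/
def LW (q : ℂ) (n : ℕ) : Matrix (Fin n) (Fin n) (Weyl q n) :=
  Mmat q n * Dmat q n - ((q - q⁻¹)⁻¹ : ℂ) • 1

/-! ### The q-immanant polynomials -/

/-- The matrix `(L_{1̄} + z q^{-2c₁(U)}) ⋯ (L_{m̄} + z q^{-2c_m(U)}) E_U`, where `E` is the
image `E_U` of the primitive idempotent `e_U`. -/
def prodU {A : Type} [Ring A] [Algebra ℂ A] (q : ℂ) (n m : ℕ) {μ : YoungDiagram}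
    (U : StdTab μ m) (E : Matrix (Fin m → Fin n) (Fin m → Fin n) ℂ)
    (X : Matrix (Fin n) (Fin n) A) (z : ℂ) :
    Matrix (Fin m → Fin n) (Fin m → Fin n) A :=
  (((List.range m).map fun k =>
      legBar q n m X k + ((z * q ^ (-2 * ctnAt U (k + 1))) : ℂ) • 1)).prod *
    E.map (algebraMap ℂ A)

/-- The q-immanant polynomial
`S_U(z) = tr_{q(1,…,m)} (L_{1̄} + z q^{-2c₁(U)}) ⋯ (L_{m̄} + z q^{-2c_m(U)}) E_U`. -/
def SUpoly {A : Type} [Ring A] [Algebra ℂ A] (q : ℂ) (n m : ℕ) {μ : YoungDiagram}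
    (U : StdTab μ m) (E : Matrix (Fin m → Fin n) (Fin m → Fin n) ℂ)
    (X : Matrix (Fin n) (Fin n) A) (z : ℂ) : A :=
  qTr q n m (prodU q n m U E X z)

/-- The coefficient `a_μ = ∏_{α ∈ μ} q^{-2c(α)}`. -/
def aCoeff (q : ℂ) (μ : YoungDiagram) : ℂ := ∏ α ∈ μ.cells, q ^ (-2 * ctn α)

/-- `tr_{q(1,…,m)} L_{1̄} ⋯ L_{m̄} E_{(1^m)}`, where `Em` is the image of the primitive
idempotent associated with the column diagram `(1^m)`. -/
def colElem (q : ℂ) (n k : ℕ) (K : Matrix (Fin n) (Fin n) (Uq q n))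
    (φk : Hecke q k →ₐ[ℂ] Matrix (Fin k → Fin n) (Fin k → Fin n) ℂ)
    (ek : Hecke q k) : Uq q n :=
  qTr q n k (((List.range k).map fun j => legBar q n k (Lmat q n K) j).prod *
    (φk ek).map (algebraMap ℂ (Uq q n)))

/-- The semistandardness condition on a filling of the boxes of `μ` with entries in
`{1, …, n}` (encoded as `Fin n`): weakly increasing along rows, strictly increasing
down columns. -/
def SSYTCond {n : ℕ} (μ : YoungDiagram) (f : {x // x ∈ μ.cells} → Fin n) : Prop :=
  (∀ a b : {x // x ∈ μ.cells}, (a : ℕ × ℕ).1 = (b : ℕ × ℕ).1 →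
    (a : ℕ × ℕ).2 ≤ (b : ℕ × ℕ).2 → f a ≤ f b) ∧
  (∀ a b : {x // x ∈ μ.cells}, (a : ℕ × ℕ).2 = (b : ℕ × ℕ).2 →
    (a : ℕ × ℕ).1 < (b : ℕ × ℕ).1 → f a < f b)

/-- The factorial Schur polynomial `s_μ(x₁,…,x_n | a)` evaluated at `x_i = q^{2ℓ_i}`,
`ℓ_i = λ_i - i + 1` (1-indexed), with parameter sequence `a_j = z q^{1-2j}`. -/
def factSchur {n : ℕ} (q z : ℂ) (lam : Fin n → ℤ) (μ : YoungDiagram) : ℂ :=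
  ∑ f : {x // x ∈ μ.cells} → Fin n,
    if SSYTCond μ f then
      ∏ α : {x // x ∈ μ.cells},
        (q ^ (2 * (lam (f α) - ((f α : ℕ) : ℤ))) +
          z * q ^ (1 - 2 * (((f α : ℕ) : ℤ) + 1 + ctn (α : ℕ × ℕ))))
    else 0

/-! ### Braid systems in a ring -/

section Braid

variable {S : Type*} [Ring S]

/-- `r 0, …, r (N - 1)` satisfy the braid relations and have inverses `s 0, …, s (N - 1)`. -/
structure IsBraidSystem (N : ℕ) (r s : ℕ → S) : Prop where
  mul_inv : ∀ k < N, r k * s k = 1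
  inv_mul : ∀ k < N, s k * r k = 1
  braid : ∀ k, k + 1 < N → r k * r (k + 1) * r k = r (k + 1) * r k * r (k + 1)
  far : ∀ j k, j + 1 < k → k < N → Commute (r j) (r k)

/-- The successive conjugates `x`, `r₀ x r₀⁻¹`, `r₁ r₀ x r₀⁻¹ r₁⁻¹`, …. -/
def bar (r s : ℕ → S) (x : S) : ℕ → S
  | 0 => x
  | k + 1 => r k * bar r s x k * s k

/-- The Jucys–Murphy-type elements `1`, `r₀²`, `r₁ r₀² r₁`, …. -/
def jm (r : ℕ → S) : ℕ → S
  | 0 => 1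
  | k + 1 => r k * jm r k * r k

theorem commute_of_inverse {a b b' : S} (h : b * b' = 1) (h' : b' * b = 1) (hab : Commute a b) :
    Commute a b' :=
  let u : Sˣ := ⟨b, b', h, h'⟩
  (show Commute a (u : S) from hab).units_inv_right

theorem braid_inv_left {a a' b b' : S} (ha' : a' * a = 1) (hb : b * b' = 1)
    (h : a * b * a = b * a * b) : a' * b * a = b * a * b' := by
  calc a' * b * a = a' * (b * a * b) * b' := by simp only [mul_assoc, hb, mul_one]
    _ = a' * a * b * a * b' := by rw [← h]; simp only [mul_assoc]
    _ = b * a * b' := by rw [ha', one_mul]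

theorem braid_inv {a a' b b' : S} (ha : a * a' = 1) (ha' : a' * a = 1) (hb : b * b' = 1)
    (hb' : b' * b = 1) (h : a * b * a = b * a * b) : a' * b' * a' = b' * a' * b' := by
  let u : Sˣ := ⟨a, a', ha, ha'⟩
  let v : Sˣ := ⟨b, b', hb, hb'⟩
  have huv : u * v * u = v * u * v := Units.ext h
  have := congrArg (fun w : Sˣ => ((w⁻¹ : Sˣ) : S)) huv
  simpa only [mul_inv_rev, Units.val_mul, mul_assoc, Units.inv_mk, u, v] using this

/-- If `d` and `l` satisfy the exchange relation with respect to `a` and commute with `b`, then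
their conjugates by `a` and `b a` satisfy it with respect to `b`. -/
theorem exchange_succ {a a' b b' d l : S} (ha : a * a' = 1) (ha' : a' * a = 1)
    (hb : b * b' = 1) (hb' : b' * b = 1) (h : a * b * a = b * a * b)
    (hd : Commute b d) (hl : Commute b l)
    (hdl : d * (a * l * a') = a * l * a' * d * a' * a') :
    a * d * a' * (b * (a * l * a') * b') = b * (a * l * a') * b' * (a * d * a') * b' * b' := by
  have hd' : Commute b' d := (commute_of_inverse hb hb' hd.symm).symm
  have hl' : Commute b' l := (commute_of_inverse hb hb' hl.symm).symm
  have hinv := braid_inv ha ha' hb hb' h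
  have e1 := braid_inv_left ha' hb h
  have e2 : a' * b' * a = b * a' * b' := by
    calc a' * b' * a = b * (b' * a' * b') * a := by simp only [← mul_assoc, hb, one_mul]
      _ = b * a' * b' * (a' * a) := by rw [← hinv]; simp only [mul_assoc]
      _ = b * a' * b' := by rw [ha', mul_one]
  calc a * d * a' * (b * (a * l * a') * b')
      = a * d * (a' * b * a) * l * a' * b' := by simp only [mul_assoc]
    _ = a * (d * b) * a * (b' * l) * a' * b' := by rw [e1]; simp only [mul_assoc]
    _ = a * b * d * a * l * (b' * a' * b') := by rw [← hd.eq, hl'.eq]; simp only [mul_assoc]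
    _ = a * b * (d * (a * l * a')) * b' * a' := by rw [← hinv]; simp only [mul_assoc]
    _ = (a * b * a) * l * a' * d * a' * (a' * b' * a') := by rw [hdl]; simp only [mul_assoc]
    _ = b * a * (b * l) * a' * d * (a' * b' * a') * b' := by
        rw [h]; conv_lhs => rw [hinv]
        simp only [mul_assoc]
    _ = b * a * l * b * a' * (d * b') * a' * b' * b' := by
        rw [hinv, hl.eq]; simp only [mul_assoc]
    _ = b * a * l * (b * a' * b') * d * a' * b' * b' := by
        rw [← hd'.eq]; simp only [mul_assoc]
    _ = b * (a * l * a') * b' * (a * d * a') * b' * b' := by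
        rw [← e2]; simp only [mul_assoc]

namespace IsBraidSystem

variable {N : ℕ} {r s : ℕ → S}

theorem commute_bar_of_lt (H : IsBraidSystem N r s) {x : S}
    (hx : ∀ j, 0 < j → j < N → Commute (r j) x) {j k : ℕ} (hkj : k < j) (hj : j < N) :
    Commute (r j) (bar r s x k) := by
  induction k with
  | zero => exact hx j hkj hj
  | succ k ih =>
    have hc : Commute (r j) (r k) := (H.far k j hkj hj).symm
    exact (hc.mul_right (ih (by omega))).mul_right
      (commute_of_inverse (H.mul_inv k (by omega)) (H.inv_mul k (by omega)) hc)

theorem commute_bar_of_gt (H : IsBraidSystem N r s) {x : S}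
    (hx : ∀ j, 0 < j → j < N → Commute (r j) x) {j k : ℕ} (hjk : j + 1 < k) (hk : k ≤ N) :
    Commute (r j) (bar r s x k) := by
  induction k with
  | zero => omega
  | succ k ih =>
    rcases Nat.lt_or_ge (j + 1) k with hlt | hge
    · have hc := H.far j k hlt (by omega)
      exact (hc.mul_right (ih hlt (by omega))).mul_right
        (commute_of_inverse (H.mul_inv k (by omega)) (H.inv_mul k (by omega)) hc)
    · obtain rfl : k = j + 1 := by omega
      have hb := H.braid j (by omega)
      have hl := H.commute_bar_of_lt hx (j := j + 1) (k := j) (by omega) (by omega)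
      have e : r (j + 1) * s j * s (j + 1) = s j * s (j + 1) * r j := by
        have := braid_inv_left (a := r (j + 1)) (a' := s (j + 1)) (b := r j) (b' := s j)
          (H.inv_mul _ (by omega)) (H.mul_inv _ (by omega)) hb.symm
        calc r (j + 1) * s j * s (j + 1)
            = s j * (r j * r (j + 1) * s j) * s (j + 1) := by
              simp only [← mul_assoc, H.inv_mul j (by omega), one_mul]
          _ = s j * s (j + 1) * r j * (r (j + 1) * s (j + 1)) := by
              rw [← this]; simp only [mul_assoc]
          _ = s j * s (j + 1) * r j := by rw [H.mul_inv _ (by omega), mul_one]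
      change r j * (r (j + 1) * (r j * bar r s x j * s j) * s (j + 1))
        = r (j + 1) * (r j * bar r s x j * s j) * s (j + 1) * r j
      calc r j * (r (j + 1) * (r j * bar r s x j * s j) * s (j + 1))
          = (r j * r (j + 1) * r j) * bar r s x j * s j * s (j + 1) := by simp only [mul_assoc]
        _ = r (j + 1) * r j * (r (j + 1) * bar r s x j) * s j * s (j + 1) := by
            rw [hb]; simp only [mul_assoc]
        _ = r (j + 1) * r j * bar r s x j * (r (j + 1) * s j * s (j + 1)) := by
            rw [hl.eq]; simp only [mul_assoc]
        _ = _ := by rw [e]; simp only [mul_assoc]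

theorem commute_jm_bar (H : IsBraidSystem N r s) {x : S}
    (hx : ∀ j, 0 < j → j < N → Commute (r j) x) {j k : ℕ} (hjk : j < k) (hk : k ≤ N) :
    Commute (jm r j) (bar r s x k) := by
  induction j with
  | zero => exact Commute.one_left _
  | succ j ih =>
    have hc := H.commute_bar_of_gt hx hjk hk
    exact (hc.mul_left (ih (by omega))).mul_left hc

theorem jm_inv_mul_jm (H : IsBraidSystem N r s) {k : ℕ} (hk : k ≤ N) : jm s k * jm r k = 1 := by
  induction k with
  | zero => exact mul_one 1
  | succ k ih =>
    calc s k * jm s k * s k * (r k * jm r k * r k)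
        = s k * (jm s k * (s k * r k) * jm r k) * r k := by simp only [mul_assoc]
      _ = 1 := by rw [H.inv_mul k hk, mul_one, ih (by omega), mul_one, H.inv_mul k hk]

theorem bar_mul (H : IsBraidSystem N r s) (x y : S) {k : ℕ} (hk : k ≤ N) :
    bar r s (x * y) k = bar r s x k * bar r s y k := by
  induction k with
  | zero => rfl
  | succ k ih =>
    calc r k * bar r s (x * y) k * s k
        = r k * bar r s x k * 1 * bar r s y k * s k := by
          rw [ih (by omega)]; simp only [mul_assoc, one_mul]
      _ = r k * bar r s x k * s k * (r k * bar r s y k * s k) := by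
          rw [← H.inv_mul k hk]; simp only [mul_assoc]

theorem bar_sub_smul_one (H : IsBraidSystem N r s) [Algebra ℂ S] (x : S) (z : ℂ) {k : ℕ}
    (hk : k ≤ N) : bar r s (x - z • 1) k = bar r s x k - z • 1 := by
  induction k with
  | zero => rfl
  | succ k ih =>
    change r k * bar r s (x - z • 1) k * s k = r k * bar r s x k * s k - z • 1
    rw [ih (by omega), mul_sub, sub_mul, mul_smul_comm, mul_one, smul_mul_assoc, H.mul_inv k hk]

theorem bar_mul_bar_succ (H : IsBraidSystem N r s) {d l : S}
    (hd : ∀ j, 0 < j → j < N → Commute (r j) d) (hl : ∀ j, 0 < j → j < N → Commute (r j) l)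
    (hdl : 0 < N → d * (r 0 * l * s 0) = r 0 * l * s 0 * d * s 0 * s 0) {k : ℕ} (hk : k < N) :
    bar r s d k * bar r s l (k + 1) = bar r s l (k + 1) * bar r s d k * s k * s k := by
  induction k with
  | zero => exact hdl hk
  | succ k ih =>
    exact exchange_succ (H.mul_inv k (by omega)) (H.inv_mul k (by omega)) (H.mul_inv _ hk)
      (H.inv_mul _ hk) (H.braid k hk) (H.commute_bar_of_lt hd (by omega) hk)
      (H.commute_bar_of_lt hl (by omega) hk) (ih (by omega))

theorem commute_prod_bar (H : IsBraidSystem N r s) {d : S}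
    (hd : ∀ j, 0 < j → j < N → Commute (r j) d) {j k : ℕ} (hkj : k ≤ j) (hj : j < N) :
    Commute (r j) ((List.range k).reverse.map (bar r s d)).prod := by
  refine Commute.list_prod_right _ _ fun x hx => ?_
  simp only [List.mem_map, List.mem_reverse, List.mem_range] at hx
  obtain ⟨i, hi, rfl⟩ := hx
  exact H.commute_bar_of_lt hd (by omega) hj

theorem prod_bar_mul_bar (H : IsBraidSystem N r s) {d l : S}
    (hd : ∀ j, 0 < j → j < N → Commute (r j) d) (hl : ∀ j, 0 < j → j < N → Commute (r j) l)
    (hdl : 0 < N → d * (r 0 * l * s 0) = r 0 * l * s 0 * d * s 0 * s 0) {k : ℕ} (hk : k ≤ N) :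
    ((List.range k).reverse.map (bar r s d)).prod * bar r s l k =
      bar r s l k * ((List.range k).reverse.map (bar r s d)).prod * jm s k := by
  induction k with
  | zero => simp [jm]
  | succ k ih =>
    have hB := H.commute_prod_bar hd le_rfl hk
    have hB' := commute_of_inverse (H.mul_inv k hk) (H.inv_mul k hk) hB.symm
    have hex := H.bar_mul_bar_succ hd hl hdl hk
    have ih := ih (by omega)
    simp only [List.range_succ, List.reverse_append, List.reverse_cons, List.reverse_nil,
      List.nil_append, List.cons_append, List.map_cons, List.prod_cons]
    set B := ((List.range k).reverse.map (bar r s d)).prod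
    set D := bar r s d k
    have hrl : r k * bar r s l k = bar r s l (k + 1) * r k := by
      change _ = r k * bar r s l k * s k * r k
      rw [mul_assoc _ (s k), H.inv_mul k hk, mul_one]
    calc D * B * bar r s l (k + 1)
        = D * (B * r k) * bar r s l k * s k := by simp only [bar, mul_assoc]
      _ = D * r k * (B * bar r s l k) * s k := by rw [← hB.eq]; simp only [mul_assoc]
      _ = D * (r k * bar r s l k) * B * jm s k * s k := by rw [ih]; simp only [mul_assoc]
      _ = (D * bar r s l (k + 1)) * r k * B * jm s k * s k := by rw [hrl]; simp only [mul_assoc]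
      _ = bar r s l (k + 1) * D * s k * (s k * r k) * B * jm s k * s k := by
          rw [hex]; simp only [mul_assoc]
      _ = bar r s l (k + 1) * D * (s k * B) * jm s k * s k := by
          rw [H.inv_mul k hk, mul_one]; simp only [mul_assoc]
      _ = bar r s l (k + 1) * (D * B) * jm s (k + 1) := by
          rw [← hB'.eq]; simp only [jm, mul_assoc]

/-- The higher Capelli identity in a ring with a braid system, for a joint eigenvector `F` of the
Jucys–Murphy elements with eigenvalues `(c k)⁻¹`. -/
theorem prod_bar_add_smul_mul [Algebra ℂ S] (H : IsBraidSystem N r s) {x d : S} {z : ℂ}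
    (hx : ∀ j, 0 < j → j < N → Commute (r j) x) (hd : ∀ j, 0 < j → j < N → Commute (r j) d)
    (hdl : 0 < N → d * (r 0 * (x * d - z • 1) * s 0) =
      r 0 * (x * d - z • 1) * s 0 * d * s 0 * s 0)
    (c : ℕ → ℂ) {k : ℕ} (hk : k ≤ N + 1) (F : S)
    (hF : ∀ j < k, c j • (jm r j * F) = F) :
    ((List.range k).map fun j => bar r s (x * d - z • 1) j + (z * c j) • 1).prod * F =
      (∏ j ∈ Finset.range k, c j) • (((List.range k).map (bar r s x)).prod *
        ((List.range k).reverse.map (bar r s d)).prod * F) := by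
  have hl : ∀ j, 0 < j → j < N → Commute (r j) (x * d - z • 1) := fun j h1 h2 =>
    ((hx j h1 h2).mul_right (hd j h1 h2)).sub_right ((Commute.one_right _).smul_right z)
  induction k generalizing F with
  | zero => simp
  | succ k ih =>
    have hk' : k ≤ N := by omega
    have hyF : jm s k * F = c k • F := by
      conv_lhs => rw [← hF k (by omega)]
      rw [mul_smul_comm, ← mul_assoc, H.jm_inv_mul_jm hk', one_mul]
    have hex := H.prod_bar_mul_bar hd hl hdl hk'
    have hL : bar r s (x * d - z • 1) k = bar r s x k * bar r s d k - z • 1 := by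
      rw [H.bar_sub_smul_one _ _ hk', H.bar_mul _ _ hk']
    have hF' : ∀ j < k, c j • (jm r j * ((bar r s (x * d - z • 1) k + (z * c k) • 1) * F)) =
        (bar r s (x * d - z • 1) k + (z * c k) • 1) * F := by
      intro j hj
      have hc : Commute (jm r j) (bar r s (x * d - z • 1) k + (z * c k) • 1) :=
        (H.commute_jm_bar hl hj hk').add_right ((Commute.one_right _).smul_right _)
      rw [← mul_assoc, hc.eq, mul_assoc, ← mul_smul_comm, hF j (by omega)]
    have ih := ih (by omega) _ hF'
    simp only [List.range_succ, List.reverse_append, List.reverse_cons, List.reverse_nil,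
      List.nil_append, List.cons_append, List.map_cons, List.prod_cons, List.map_append,
      List.map_nil, List.prod_append, List.prod_nil, mul_one]
    rw [mul_assoc, ih, Finset.prod_range_succ, mul_smul (∏ j ∈ Finset.range k, c j)]
    congr 1
    set B := ((List.range k).reverse.map (bar r s d)).prod
    set A := ((List.range k).map (bar r s x)).prod
    have key : B * ((bar r s (x * d - z • 1) k + (z * c k) • 1) * F) =
        c k • (bar r s x k * bar r s d k * B * F) := by
      calc B * ((bar r s (x * d - z • 1) k + (z * c k) • 1) * F)
          = B * bar r s (x * d - z • 1) k * F + (z * c k) • (B * F) := by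
            rw [add_mul, mul_add, smul_mul_assoc, one_mul, mul_smul_comm, mul_assoc]
        _ = bar r s (x * d - z • 1) k * B * (jm s k * F) + (z * c k) • (B * F) := by
            rw [hex]; simp only [mul_assoc]
        _ = c k • (bar r s x k * bar r s d k * B * F) := by
            rw [hyF, hL, mul_smul_comm, sub_mul, sub_mul, smul_mul_assoc, one_mul,
              smul_mul_assoc, smul_sub, smul_smul, mul_comm z, sub_add_cancel]
    rw [mul_assoc A, key, mul_smul_comm]
    simp only [mul_assoc]

end IsBraidSystem

/-- The exchange relation between `d` and `l = x d - z` in the first two legs. -/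
theorem exchange_of_weyl [Algebra ℂ S] {a a' x d : S} {q : ℂ} (hq : q - q⁻¹ ≠ 0)
    (ha : a * a' = 1) (ha' : a' * a = 1) (hquad : a * a = 1 + (q - q⁻¹) • a)
    (hdd : a' * d * a' * d = d * a' * d * a') (hdx : d * a * x = a * x * a' * d * a' + 1) :
    d * (a * (x * d - (q - q⁻¹)⁻¹ • 1) * a') =
      a * (x * d - (q - q⁻¹)⁻¹ • 1) * a' * d * a' * a' := by
  have hz : (q - q⁻¹)⁻¹ • (1 - a' * a') = a' := by
    have h1 : a' * a' * (a * a) = 1 := by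
      rw [mul_assoc, ← mul_assoc a' a, ha', one_mul, ha']
    have h2 : 1 - a' * a' = (q - q⁻¹) • a' := by
      calc 1 - a' * a' = a' * a' * (a * a) - a' * a' := by rw [h1]
        _ = (q - q⁻¹) • a' := by
          rw [hquad, mul_add, mul_one, mul_smul_comm, mul_assoc, ha', mul_one,
            add_sub_cancel_left]
    rw [h2, smul_smul, inv_mul_cancel₀ hq, one_smul]
  have h3 : d * (a * (x * d) * a') = a * (x * d) * a' * d * a' * a' + d * a' := by
    calc d * (a * (x * d) * a') = (d * a * x) * d * a' := by simp only [mul_assoc]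
      _ = a * x * (a' * d * a' * d) * a' + d * a' := by
        rw [hdx, add_mul, add_mul, one_mul]; simp only [mul_assoc]
      _ = _ := by rw [hdd]; simp only [mul_assoc]
  have h4 : d * a' = (q - q⁻¹)⁻¹ • d - (q - q⁻¹)⁻¹ • (d * a' * a') := by
    conv_lhs => rw [← hz]
    rw [mul_smul_comm, mul_sub, mul_one, smul_sub, mul_assoc]
  simp only [mul_sub, sub_mul, mul_smul_comm, smul_mul_assoc, mul_one, ha, one_mul]
  rw [h3, add_sub_assoc, sub_eq_add_neg (a * (x * d) * a' * d * a' * a')]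
  congr 1
  refine sub_eq_iff_eq_add.2 (h4.trans ?_)
  abel

end Braid

/-! ### Matrices acting on some tensor legs -/

section Legs

/-- The matrix acting as `X` on the first factor of a decomposition `I ≃ α × β` of the index set,
and trivially on the second factor. -/
def splitEmb {A I α β : Type*} [Ring A] (E : I ≃ α × β) (X : Matrix α α A) : Matrix I I A :=
  fun i j => if (E i).2 = (E j).2 then X (E i).1 (E j).1 else 0

theorem splitEmb_mul {A I α β : Type*} [Ring A] [Fintype I] [Fintype α] [Fintype β]
    (E : I ≃ α × β) (X Y : Matrix α α A) :
    splitEmb E (X * Y) = splitEmb E X * splitEmb E Y := by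
  ext i j
  rw [Matrix.mul_apply, ← E.symm.sum_comp, Fintype.sum_prod_type]
  have h : ∀ x y, splitEmb E X i (E.symm (x, y)) * splitEmb E Y (E.symm (x, y)) j =
      if (E i).2 = y then
        if (E i).2 = (E j).2 then X (E i).1 x * Y x (E j).1 else 0
      else 0 := fun x y => by
    simp only [splitEmb, Equiv.apply_symm_apply]
    split_ifs <;> simp_all
  simp only [h, Finset.sum_ite_eq, Finset.mem_univ, if_true]
  by_cases hij : (E i).2 = (E j).2 <;> simp [splitEmb, Matrix.mul_apply, hij]

theorem splitEmb_one {A I α β : Type*} [Ring A] [DecidableEq I] [DecidableEq α]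
    (E : I ≃ α × β) : splitEmb E (1 : Matrix α α A) = 1 := by
  ext i j
  simp only [splitEmb, Matrix.one_apply, ← ite_and, ← E.injective.eq_iff (a := i),
    Prod.ext_iff (x := E i), and_comm]

theorem splitEmb_add {A I α β : Type*} [Ring A] (E : I ≃ α × β) (X Y : Matrix α α A) :
    splitEmb E (X + Y) = splitEmb E X + splitEmb E Y := by
  ext i j
  simp only [splitEmb, Matrix.add_apply]
  split_ifs <;> simp

theorem splitEmb_sub {A I α β : Type*} [Ring A] (E : I ≃ α × β) (X Y : Matrix α α A) :
    splitEmb E (X - Y) = splitEmb E X - splitEmb E Y := by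
  ext i j
  simp only [splitEmb, Matrix.sub_apply]
  split_ifs <;> simp

theorem splitEmb_smul {A I α β : Type*} [Ring A] [Algebra ℂ A] (E : I ≃ α × β) (c : ℂ)
    (X : Matrix α α A) : splitEmb E (c • X) = c • splitEmb E X := by
  ext i j
  simp only [splitEmb, Matrix.smul_apply]
  split_ifs <;> simp

/-- Splitting two coordinates off a function. -/
def pairSplit {ι β : Type*} [DecidableEq ι] {a b : ι} (hab : a ≠ b) :
    (ι → β) ≃ (β × β) × ({c // c ≠ a ∧ c ≠ b} → β) where
  toFun i := ((i a, i b), fun c => i c)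
  invFun p := fun c =>
    if h : c = a then p.1.1 else if h' : c = b then p.1.2 else p.2 ⟨c, h, h'⟩
  left_inv i := by
    ext c
    dsimp only
    split_ifs with h h' <;> simp_all
  right_inv p := by
    obtain ⟨⟨x, y⟩, f⟩ := p
    ext c
    · simp
    · simp [hab.symm]
    · simp [c.2.1, c.2.2]

variable {A : Type} [Ring A]

theorem leg1_eq_splitEmb {n m : ℕ} (X : Matrix (Fin n) (Fin n) A) {a : ℕ} (ha : a < m) :
    leg1 n m X a = splitEmb (Equiv.funSplitAt (⟨a, ha⟩ : Fin m) (Fin n)) X := by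
  ext i j
  simp [leg1, splitEmb, ha, funext_iff, Equiv.funSplitAt, Equiv.piSplitAt, Fin.ext_iff]

theorem leg2_eq_splitEmb [Algebra ℂ A] {n m : ℕ} (C : Matrix (Fin n × Fin n) (Fin n × Fin n) ℂ)
    {a b : Fin m} (hab : a ≠ b) :
    leg2 A n m C a b = splitEmb (pairSplit hab) (C.map (algebraMap ℂ A)) := by
  ext i j
  simp [leg2, splitEmb, pairSplit, funext_iff, Fin.ext_iff]

theorem leg1_zero_eq_splitEmb_M1 {n m : ℕ} (X : Matrix (Fin n) (Fin n) A) {a b : Fin m}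
    (hab : a ≠ b) : leg1 n m X a = splitEmb (pairSplit hab) (M1 X) := by
  ext i j
  have : (∀ c : Fin m, (c : ℕ) ≠ a → i c = j c) ↔
      (∀ c : Fin m, c ≠ a ∧ c ≠ b → i c = j c) ∧ i b = j b := by
    constructor
    · intro h
      exact ⟨fun c hc => h c (by simpa [Fin.ext_iff] using hc.1),
        h b (by simpa [Fin.ext_iff] using hab.symm)⟩
    · rintro ⟨h, hb⟩ c hc
      by_cases hcb : c = b
      · rw [hcb, hb]
      · exact h c ⟨by simpa [Fin.ext_iff] using hc, hcb⟩
  simp only [leg1, this, splitEmb, pairSplit, M1, Equiv.coe_fn_mk, funext_iff, Subtype.forall,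
    Fin.is_lt, dite_true, ite_and, Fin.eta]
  congr

theorem commute_leg2_leg1 [Algebra ℂ A] {n m : ℕ} (C : Matrix (Fin n × Fin n) (Fin n × Fin n) ℂ)
    (X : Matrix (Fin n) (Fin n) A) {a b c : ℕ} (ha : a < m) (hb : b < m) (hc : c < m)
    (hca : c ≠ a) (hcb : c ≠ b) : Commute (leg2 A n m C a b) (leg1 n m X c) := by
  ext i j
  rw [Matrix.mul_apply, Matrix.mul_apply,
    Finset.sum_eq_single (Function.update j ⟨c, hc⟩ (i ⟨c, hc⟩)),
    Finset.sum_eq_single (Function.update i ⟨c, hc⟩ (j ⟨c, hc⟩))]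
  · have h1 : (∀ d : Fin m, (d : ℕ) ≠ a → (d : ℕ) ≠ b →
        i d = Function.update j ⟨c, hc⟩ (i ⟨c, hc⟩) d) ↔
        (∀ d : Fin m, (d : ℕ) ≠ a → (d : ℕ) ≠ b →
          Function.update i ⟨c, hc⟩ (j ⟨c, hc⟩) d = j d) := by
      refine forall_congr' fun d => imp_congr_right fun _ => imp_congr_right fun _ => ?_
      rcases eq_or_ne d ⟨c, hc⟩ with rfl | hd
      · simp
      · simp [hd]
    have h2 : ∀ f : Fin m → Fin n, ∀ x : Fin n, ∀ d : Fin m, (d : ℕ) ≠ c →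
        Function.update f ⟨c, hc⟩ x d = f d := fun f x d hd =>
      Function.update_of_ne (by simpa [Fin.ext_iff] using hd) _ _
    have h3 : ∀ d : Fin m, (d : ℕ) ≠ c → i d = Function.update i ⟨c, hc⟩ (j ⟨c, hc⟩) d :=
      fun d hd => (h2 _ _ d hd).symm
    simp only [leg1, leg2, ha, hb, hc, and_self, dite_true, h1]
    rw [if_pos (h2 j _), if_pos h3, h2 j _ ⟨a, ha⟩ hca.symm, h2 j _ ⟨b, hb⟩ hcb.symm,
      h2 i _ ⟨a, ha⟩ hca.symm, h2 i _ ⟨b, hb⟩ hcb.symm]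
    simp only [Function.update_self]
    split_ifs
    · exact Algebra.commutes _ _
    · simp
  · intro k _ hk
    by_cases h : ∀ d : Fin m, (d : ℕ) ≠ c → i d = k d
    · have h' : ¬ ∀ d : Fin m, (d : ℕ) ≠ a → (d : ℕ) ≠ b → k d = j d := by
        refine fun h' => hk (funext fun d => ?_)
        rcases eq_or_ne d ⟨c, hc⟩ with rfl | hd
        · simp [h' ⟨c, hc⟩ hca hcb]
        · simp [hd, h d (by simpa [Fin.ext_iff] using hd)]
      simp [leg2, h']
    · simp [leg1, h]
  · simp
  · intro k _ hk
    by_cases h : ∀ d : Fin m, (d : ℕ) ≠ c → k d = j d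
    · have h' : ¬ ∀ d : Fin m, (d : ℕ) ≠ a → (d : ℕ) ≠ b → i d = k d := by
        refine fun h' => hk (funext fun d => ?_)
        rcases eq_or_ne d ⟨c, hc⟩ with rfl | hd
        · simp [h' ⟨c, hc⟩ hca hcb]
        · simp [hd, h d (by simpa [Fin.ext_iff] using hd)]
      simp [leg2, h']
    · simp [leg1, h]
  · simp

end Legs

/-! ### The matrix `Ř` -/

theorem Rcheck_apply (q : ℂ) (n : ℕ) (a b : Fin n) (r : Fin n × Fin n) :
    Rcheck q n (a, b) r = (if a = b then q else 1) * (if (b, a) = r then 1 else 0) +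
      (if b < a then q - q⁻¹ else 0) * (if (a, b) = r then 1 else 0) := by
  have h : Rcheck q n (a, b) r = Rmat q n (b, a) r := by
    rw [Rcheck, Matrix.mul_apply, Finset.sum_eq_single (b, a)]
    · simp [Pmat]
    · rintro ⟨x, y⟩ - hxy
      have : ¬ (a = y ∧ b = x) := by rintro ⟨rfl, rfl⟩; exact hxy rfl
      simp [Pmat, this]
    · simp
  obtain ⟨c, d⟩ := r
  rw [h]
  simp only [Rmat, Prod.mk.injEq]
  split_ifs <;> grind

theorem Rcheck_mul_self {q : ℂ} (hq : q ≠ 0) (n : ℕ) :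
    Rcheck q n * Rcheck q n = 1 + (q - q⁻¹) • Rcheck q n := by
  ext ⟨a, b⟩ r
  have h : (Rcheck q n * Rcheck q n) (a, b) r = (if a = b then q else 1) * Rcheck q n (b, a) r +
      (if b < a then q - q⁻¹ else 0) * Rcheck q n (a, b) r := by
    have hsum : ∀ (u v : ℂ) (f : Fin n × Fin n → ℂ),
        ∑ x, (u * (if (b, a) = x then 1 else 0) + v * (if (a, b) = x then 1 else 0)) * f x =
          u * f (b, a) + v * f (a, b) := fun u v f => by
      simp only [add_mul, mul_assoc, Finset.sum_add_distrib, ← Finset.mul_sum, ite_mul, one_mul,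
        zero_mul, Finset.sum_ite_eq, Finset.mem_univ, if_true]
    rw [Matrix.mul_apply]
    exact (Finset.sum_congr rfl fun x _ => by rw [Rcheck_apply q n a b x]).trans
      (hsum _ _ fun x => Rcheck q n x r)
  rw [h, Matrix.add_apply, Matrix.smul_apply, smul_eq_mul, Matrix.one_apply]
  rcases lt_trichotomy a b with hab | rfl | hab
  · simp [Rcheck_apply, hab, hab.ne, hab.ne', hab.not_gt, add_comm]
  · have : q * q = 1 + (q - q⁻¹) * q := by field_simp; ring
    simp only [Rcheck_apply, lt_irrefl, if_true, if_false, zero_mul, add_zero]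
    split_ifs <;> simp [this]
  · simp [Rcheck_apply, hab, hab.ne, hab.ne', hab.not_gt]

theorem Rcheck_mul_inv {q : ℂ} (hq : q ≠ 0) (n : ℕ) : Rcheck q n * (Rcheck q n)⁻¹ = 1 := by
  have h : Rcheck q n * (Rcheck q n - (q - q⁻¹) • 1) = 1 := by
    rw [mul_sub, Rcheck_mul_self hq, mul_smul_comm, mul_one, add_sub_cancel_right]
  rwa [Matrix.inv_eq_right_inv h]

section RcLeg

variable (A : Type) [Ring A] [Algebra ℂ A] {q : ℂ} {n m : ℕ}

theorem RcLeg_mul_RcLegInv (hq : q ≠ 0) {k : ℕ} (hk : k < m - 1) :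
    RcLeg A q n m k * RcLegInv A q n m k = 1 := by
  have hne : (⟨k, by omega⟩ : Fin m) ≠ ⟨k + 1, by omega⟩ := by simp
  have h1 := leg2_eq_splitEmb (A := A) (Rcheck q n) hne
  have h2 := leg2_eq_splitEmb (A := A) (Rcheck q n)⁻¹ hne
  rw [RcLeg, RcLegInv, h1, h2, ← splitEmb_mul, ← Matrix.map_mul, Rcheck_mul_inv hq,
    Matrix.map_one _ (map_zero _) (map_one _), splitEmb_one]

theorem RcLegInv_mul_RcLeg (hq : q ≠ 0) {k : ℕ} (hk : k < m - 1) :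
    RcLegInv A q n m k * RcLeg A q n m k = 1 := by
  have hne : (⟨k, by omega⟩ : Fin m) ≠ ⟨k + 1, by omega⟩ := by simp
  have h1 := leg2_eq_splitEmb (A := A) (Rcheck q n) hne
  have h2 := leg2_eq_splitEmb (A := A) (Rcheck q n)⁻¹ hne
  rw [RcLeg, RcLegInv, h1, h2, ← splitEmb_mul, ← Matrix.map_mul,
    mul_eq_one_comm.1 (Rcheck_mul_inv hq n),
    Matrix.map_one _ (map_zero _) (map_one _), splitEmb_one]

theorem RcLeg_mul_self (hq : q ≠ 0) {k : ℕ} (hk : k < m - 1) :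
    RcLeg A q n m k * RcLeg A q n m k = 1 + (q - q⁻¹) • RcLeg A q n m k := by
  have hne : (⟨k, by omega⟩ : Fin m) ≠ ⟨k + 1, by omega⟩ := by simp
  have h1 := leg2_eq_splitEmb (A := A) (Rcheck q n) hne
  have h2 : ((Rcheck q n * Rcheck q n).map (algebraMap ℂ A)) =
      1 + (q - q⁻¹) • (Rcheck q n).map (algebraMap ℂ A) := by
    rw [Rcheck_mul_self hq]
    change (Algebra.ofId ℂ A).mapMatrix _ = 1 + (q - q⁻¹) • (Algebra.ofId ℂ A).mapMatrix _
    simp only [map_add, map_one, map_smul]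
  rw [RcLeg, h1, ← splitEmb_mul, ← Matrix.map_mul, h2, splitEmb_add, splitEmb_smul,
    splitEmb_one]

theorem RcLeg_eq_mapMatrix (k : ℕ) :
    RcLeg A q n m k = (Algebra.ofId ℂ A).mapMatrix (RcLeg ℂ q n m k) := by
  ext i j
  simp only [RcLeg, leg2, AlgHom.mapMatrix_apply, Matrix.map_apply, Algebra.ofId_apply,
    Algebra.algebraMap_self, RingHom.id_apply]
  split_ifs <;> simp

theorem Tgen_braid (i j : Fin (m - 1)) (h : (j : ℕ) = i + 1) :
    Tgen q m i * Tgen q m j * Tgen q m i = Tgen q m j * Tgen q m i * Tgen q m j := by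
  simpa only [map_mul, Tgen] using RingQuot.mkAlgHom_rel ℂ (HeckeRel.braid (q := q) i j h)

theorem Tgen_commute (i j : Fin (m - 1)) (h : (i : ℕ) + 1 < j) :
    Commute (Tgen q m i) (Tgen q m j) := by
  simpa only [map_mul, Tgen, commute_iff_eq] using
    RingQuot.mkAlgHom_rel ℂ (HeckeRel.commute (q := q) i j h)

theorem isBraidSystem_RcLeg (hq : q ≠ 0)
    {φ : Hecke q m →ₐ[ℂ] Matrix (Fin m → Fin n) (Fin m → Fin n) ℂ} (hφ : IsHeckeRep q n m φ) :
    IsBraidSystem (m - 1) (RcLeg A q n m) (RcLegInv A q n m) := by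
  have hT : ∀ (k : ℕ) (hk : k < m - 1), RcLeg A q n m k =
      (Algebra.ofId ℂ A).mapMatrix (φ (Tgen q m ⟨k, hk⟩)) := fun k hk => by
    rw [RcLeg_eq_mapMatrix, ← hφ k hk, Tn, dif_pos hk]
  refine ⟨fun k hk => RcLeg_mul_RcLegInv A hq hk, fun k hk => RcLegInv_mul_RcLeg A hq hk,
    fun k hk => ?_, fun j k hjk hk => ?_⟩
  · rw [hT k (by omega), hT (k + 1) hk]
    simp only [← map_mul, Tgen_braid (q := q) ⟨k, by omega⟩ ⟨k + 1, hk⟩ rfl]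
  · rw [hT j (by omega), hT k hk]
    exact ((Tgen_commute _ _ hjk).map φ).map _

theorem jm_RcLeg {φ : Hecke q m →ₐ[ℂ] Matrix (Fin m → Fin n) (Fin m → Fin n) ℂ}
    (hφ : IsHeckeRep q n m φ) {k : ℕ} (hk : k < m) :
    jm (RcLeg A q n m) k = (Algebra.ofId ℂ A).mapMatrix (φ (yJM q m (k + 1))) := by
  induction k with
  | zero => simp only [jm, yJM, map_one]
  | succ k ih =>
    simp only [jm, yJM, Tp, Nat.add_sub_cancel, map_mul, hφ k (by omega), ih (by omega),
      ← RcLeg_eq_mapMatrix]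

theorem legBar_eq_bar (X : Matrix (Fin n) (Fin n) A) :
    legBar q n m X = bar (RcLeg A q n m) (RcLegInv A q n m) (leg1 n m X 0) := by
  funext k
  induction k with
  | zero => rfl
  | succ k ih => simp only [legBar, bar, ih]

theorem commute_RcLeg_leg1 (X : Matrix (Fin n) (Fin n) A) (j : ℕ) (h0 : 0 < j) (hj : j < m - 1) :
    Commute (RcLeg A q n m j) (leg1 n m X 0) :=
  commute_leg2_leg1 _ _ (by omega) (by omega) (by omega) (by omega) (by omega)

theorem qTr_smul (c : ℂ) (Y : Matrix (Fin m → Fin n) (Fin m → Fin n) A) :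
    qTr q n m (c • Y) = c • qTr q n m Y := by
  simp only [qTr, Matrix.smul_apply, mul_smul_comm, Finset.smul_sum]

end RcLeg

/-! ### Relations of the braided Weyl algebra in the first two legs -/

section Weyl

variable {q : ℂ} {n m : ℕ}

theorem mapMatrix_M1 {F G : Type} [Ring F] [Ring G] [Algebra ℂ F] [Algebra ℂ G] (f : F →ₐ[ℂ] G)
    (X : Fin n → Fin n → F) : f.mapMatrix (M1 X) = M1 fun i j => f (X i j) := by
  ext i j
  simp only [AlgHom.mapMatrix_apply, Matrix.map_apply, M1]
  split_ifs <;> simp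

theorem mapMatrix_map_algebraMap {I F G : Type} [Fintype I] [DecidableEq I] [Ring F] [Ring G]
    [Algebra ℂ F] [Algebra ℂ G] (f : F →ₐ[ℂ] G)
    (C : Matrix I I ℂ) :
    f.mapMatrix (C.map (algebraMap ℂ F)) = C.map (algebraMap ℂ G) := by
  ext i j
  simp

theorem Dmat_rel :
    ((Rcheck q n)⁻¹).map (algebraMap ℂ (Weyl q n)) * M1 (Dmat q n) *
        ((Rcheck q n)⁻¹).map (algebraMap ℂ (Weyl q n)) * M1 (Dmat q n) =
      M1 (Dmat q n) * ((Rcheck q n)⁻¹).map (algebraMap ℂ (Weyl q n)) * M1 (Dmat q n) *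
        ((Rcheck q n)⁻¹).map (algebraMap ℂ (Weyl q n)) := by
  have h := Matrix.ext fun x y => RingQuot.mkAlgHom_rel ℂ (WRel.dd (q := q) (n := n) x y)
  change (RingQuot.mkAlgHom ℂ (WRel q n)).mapMatrix _ =
    (RingQuot.mkAlgHom ℂ (WRel q n)).mapMatrix _ at h
  simp only [map_mul, RcWInv, mapMatrix_M1, mapMatrix_map_algebraMap] at h
  exact h

theorem Dmat_Mmat_rel :
    M1 (Dmat q n) * (Rcheck q n).map (algebraMap ℂ (Weyl q n)) * M1 (Mmat q n) =
      (Rcheck q n).map (algebraMap ℂ (Weyl q n)) * M1 (Mmat q n) *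
        ((Rcheck q n)⁻¹).map (algebraMap ℂ (Weyl q n)) * M1 (Dmat q n) *
        ((Rcheck q n)⁻¹).map (algebraMap ℂ (Weyl q n)) + 1 := by
  have h := Matrix.ext fun x y => RingQuot.mkAlgHom_rel ℂ (WRel.dm (q := q) (n := n) x y)
  change (RingQuot.mkAlgHom ℂ (WRel q n)).mapMatrix _ =
    (RingQuot.mkAlgHom ℂ (WRel q n)).mapMatrix _ at h
  simp only [map_mul, map_add, map_one, RcW, RcWInv, mapMatrix_M1, mapMatrix_map_algebraMap] at h
  exact h

theorem leg1_LW (hm : 0 < m) : leg1 n m (LW q n) 0 =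
    leg1 n m (Mmat q n) 0 * leg1 n m (Dmat q n) 0 - (q - q⁻¹)⁻¹ • 1 := by
  rw [leg1_eq_splitEmb _ hm, leg1_eq_splitEmb _ hm, leg1_eq_splitEmb _ hm, LW, splitEmb_sub,
    splitEmb_mul, splitEmb_smul, splitEmb_one]

theorem leg1_exchange (hq : q ≠ 0) (hq' : q - q⁻¹ ≠ 0) (hm : 0 < m - 1) :
    let R := RcLeg (Weyl q n) q n m 0
    let R' := RcLegInv (Weyl q n) q n m 0
    let x := leg1 n m (Mmat q n) 0
    let d := leg1 n m (Dmat q n) 0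
    d * (R * (x * d - (q - q⁻¹)⁻¹ • 1) * R') =
      R * (x * d - (q - q⁻¹)⁻¹ • 1) * R' * d * R' * R' := by
  have hne : (⟨0, by omega⟩ : Fin m) ≠ ⟨1, by omega⟩ := by simp
  have h1 := leg2_eq_splitEmb (A := Weyl q n) (Rcheck q n) hne
  have h2 := leg2_eq_splitEmb (A := Weyl q n) (Rcheck q n)⁻¹ hne
  have h3 := leg1_zero_eq_splitEmb_M1 (Mmat q n) hne
  have h4 := leg1_zero_eq_splitEmb_M1 (Dmat q n) hne
  refine exchange_of_weyl hq' (RcLeg_mul_RcLegInv _ hq hm) (RcLegInv_mul_RcLeg _ hq hm)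
    (RcLeg_mul_self _ hq hm) ?_ ?_
  · rw [RcLegInv, h2, h4]
    simp only [← splitEmb_mul, Dmat_rel]
  · rw [RcLeg, RcLegInv, h1, h2, h3, h4]
    simp only [← splitEmb_mul, Dmat_Mmat_rel, splitEmb_add, splitEmb_one]

end Weyl

theorem aCoeff_eq_prod_range (q : ℂ) {m : ℕ} {μ : YoungDiagram} (U : StdTab μ m) :
    aCoeff q μ = ∏ k ∈ Finset.range m, q ^ (-2 * ctnAt U (k + 1)) := by
  refine (Finset.prod_bij (fun k _ => U.pos (k + 1)) (fun k hk => ?_) (fun k hk l hl h => ?_)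
    (fun α hα => ?_) fun k hk => rfl).symm
  · exact U.bij.mapsTo ⟨by omega, Finset.mem_range.1 hk⟩
  · have := U.bij.injOn ⟨by omega, Finset.mem_range.1 hk⟩ ⟨by omega, Finset.mem_range.1 hl⟩ h
    omega
  · obtain ⟨k, ⟨h1, h2⟩, rfl⟩ := U.bij.surjOn hα
    exact ⟨k - 1, Finset.mem_range.2 (by omega), by rw [Nat.sub_add_cancel h1]⟩

/-- the image of the q-immanant polynomial `S_μ(z)` at `z = (q−q⁻¹)⁻¹` under
`L ↦ M𝒟 − (q−q⁻¹)⁻¹` is `a_μ tr_{q(1,…,m)} M_{1̄} ⋯ M_{m̄} 𝒟_{m̄} ⋯ 𝒟_{1̄} E_U`. -/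
theorem higher_capelli_qtrace (n : ℕ) (hn : 1 ≤ n) (q : ℂ) (hq : q ≠ 0)
    (hq' : NotRootOfUnity q) (m : ℕ) (μ : YoungDiagram) (hcard : μ.cells.card = m)
    (hrow : ∀ c ∈ μ.cells, c.1 < n) (U : StdTab μ m)
    (φ : Hecke q m →ₐ[ℂ] Matrix (Fin m → Fin n) (Fin m → Fin n) ℂ)
    (hφ : IsHeckeRep q n m φ) (e : Hecke q m) (he : IsJMIdem q m U e) :
    SUpoly q n m U (φ e) (LW q n) ((q - q⁻¹)⁻¹) =
      aCoeff q μ •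
        qTr q n m
          (((List.range m).map fun k => legBar q n m (Mmat q n) k).prod *
            ((List.range m).reverse.map fun k => legBar q n m (Dmat q n) k).prod *
            (φ e).map (algebraMap ℂ (Weyl q n))) := by
  have hz : q - q⁻¹ ≠ 0 := fun h => hq' 2 two_pos <| by
    calc q ^ 2 = q * q⁻¹ := by rw [sq, ← sub_eq_zero.1 h]
      _ = 1 := mul_inv_cancel₀ hq
  have H := isBraidSystem_RcLeg (Weyl q n) hq hφ
  have hF : ∀ j < m, (q ^ (-2 * ctnAt U (j + 1)) : ℂ) •
      (jm (RcLeg (Weyl q n) q n m) j * (φ e).map (algebraMap ℂ (Weyl q n))) =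
      (φ e).map (algebraMap ℂ (Weyl q n)) := fun j hj => by
    change _ • (_ * (Algebra.ofId ℂ (Weyl q n)).mapMatrix (φ e)) =
      (Algebra.ofId ℂ (Weyl q n)).mapMatrix (φ e)
    rw [jm_RcLeg _ hφ hj, ← map_mul, ← map_mul, (he.2.2 (j + 1) (by omega) hj).1, map_smul,
      map_smul, smul_smul, ← zpow_add₀ hq, neg_mul, neg_add_cancel, zpow_zero, one_smul]
  rw [SUpoly, prodU, ← qTr_smul, aCoeff_eq_prod_range q U]
  congr 1
  rcases Nat.eq_zero_or_pos m with rfl | hm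
  · simp
  · simp only [legBar_eq_bar, leg1_LW hm]
    exact H.prod_bar_add_smul_mul (commute_RcLeg_leg1 _ _) (commute_RcLeg_leg1 _ _)
      (leg1_exchange hq hz) _ (by omega) _ hF

end QImm
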